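/- Let g_{αβ} be a smooth symmetric nondegenerate (e.g. Lorentzian) metric on an open subset of ℝ⁴ with inverse g^{αβ}, Christoffel symbols Γ^γ_{αβ}=½g^{γδ}(∂_αg_{βδ}+∂_βg_{αδ}−∂_δg_{αβ}), Ricci tensor R_{αβ}=∂_γΓ^γ_{αβ}−∂_βΓ^γ_{αγ}+Γ^γ_{γρ}Γ^ρ_{αβ}−Γ^γ_{αρ}Γ^ρ_{βγ}, and Γ^α=g^{βγ}Γ^α_{βγ}, Γ_α=g_{αδ}Γ^δ. Then R_{αβ} = −½g^{γδ}∂_γ∂_δg_{αβ} + ½Γ^δ∂_δg_{αβ} + ½(∂_αΓ_β+∂_βΓ_α) − ½Γ_αΓ_β + ½Γ^γ_{αγ}Γ^ρ_{βρ} − ¼g^{γδ}g^{ρσ}∂_αg_{δρ}∂_βg_{σγ} + Q¹_{αβ}+Q²_{αβ}+Q³_{αβ}+Q⁴_{αβ}, where: Q¹_{αβ}=½(∂_γg^{γδ}∂_αg_{βδ}−∂_αg^{γδ}∂_γg_{βδ})+½(∂_γg^{γδ}∂_βg_{αδ}−∂_βg^{γδ}∂_γg_{αδ})+¼g^{ρσ}g^{δγ}∂_γg_{ρσ}∂_δg_{αβ};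 Q²_{αβ}=¼(∂_αg^{γδ}∂_βg_{γδ}−∂_βg^{γδ}∂_αg_{γδ}); Q³_{αβ}=¼g^{ρσ}g^{γδ}[(∂_ρg_{γδ}∂_αg_{βσ}−∂_αg_{γδ}∂_ρg_{βσ})+(∂_ρg_{γδ}∂_βg_{ασ}−∂_βg_{γδ}∂_ρg_{ασ})−∂_ρg_{γδ}∂_σg_{αβ}]; Q⁴_{αβ}=−¼g^{γδ}g^{ρσ}[(∂_αg_{δρ}∂_γg_{βσ}−∂_γg_{δρ}∂_αg_{βσ})−(∂_αg_{δρ}∂_σg_{βγ}−∂_σg_{δρ}∂_αg_{βγ})]−¼g^{γδ}g^{ρσ}[(∂_βg_{σγ}∂_ρg_{αδ}−∂_ρg_{σγ}∂_βg_{αδ})−(∂_βg_{σγ}∂_δg_{αρ}−∂_δg_{σγ}∂_βg_{αρ})]+¼g^{γδ}g^{ρσ}∂_ρg_{αδ}∂_σg_{βγ}+¼g^{γδ}g^{ρσ}∂_δg_{αρ}∂_γg_{βσ}−½g^{γδ}g^{ρσ}(∂_ρg_{αδ}∂_γg_{βσ}−∂_γg_{αδ}∂_ρg_{βσ}). In particular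 each Qⁱ is a linear combination, with coefficients quadratic in g and g^{−1}, of classical null forms in ∂g. -/

import Mathlib

noncomputable section

abbrev V4 : Type := Fin 4 → ℝ

/-- Coordinate partial derivative on `ℝ⁴`. -/
def pd4 (α : Fin 4) (f : V4 → ℝ) (p : V4) : ℝ := fderiv ℝ f p (Pi.single α 1)

/-- `∂_μ g_{ab}`. -/
def dgl (g : V4 → Fin 4 → Fin 4 → ℝ) (μ a b : Fin 4) (p : V4) : ℝ :=
  pd4 μ (fun q => g q a b) p

/-- `∂_μ g^{ab}` (derivative of the inverse metric). -/
def dgu (G : V4 → Fin 4 → Fin 4 → ℝ) (μ a b : Fin 4) (p : V4) : ℝ :=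
  pd4 μ (fun q => G q a b) p

/-- Christoffel symbols `Γ^γ_{αβ}`. -/
def Chr (g G : V4 → Fin 4 → Fin 4 → ℝ) (p : V4) (γ α β : Fin 4) : ℝ :=
  (1/2) * ∑ δ : Fin 4, G p γ δ *
    (dgl g α β δ p + dgl g β α δ p - dgl g δ α β p)

/-- Ricci curvature `R_{αβ}`. -/
def Ric (g G : V4 → Fin 4 → Fin 4 → ℝ) (p : V4) (α β : Fin 4) : ℝ :=
  (∑ γ : Fin 4, pd4 γ (fun q => Chr g G q γ α β) p)
  - (∑ γ : Fin 4, pd4 β (fun q => Chr g G q γ α γ) p)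
  + (∑ γ : Fin 4, ∑ ρ : Fin 4, Chr g G p γ γ ρ * Chr g G p ρ α β)
  - (∑ γ : Fin 4, ∑ ρ : Fin 4, Chr g G p γ α ρ * Chr g G p ρ β γ)

/-- `Γ^α = g^{βγ}Γ^α_{βγ}`. -/
def ChrUp (g G : V4 → Fin 4 → Fin 4 → ℝ) (p : V4) (α : Fin 4) : ℝ :=
  ∑ β : Fin 4, ∑ γ : Fin 4, G p β γ * Chr g G p α β γ

/-- `Γ_α = g_{αδ}Γ^δ`. -/
def ChrLow (g G : V4 → Fin 4 → Fin 4 → ℝ) (p : V4) (α : Fin 4) : ℝ :=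
  ∑ δ : Fin 4, g p α δ * ChrUp g G p δ

/-- The null-form remainder `Q¹`. -/
def Q1 (g G : V4 → Fin 4 → Fin 4 → ℝ) (p : V4) (α β : Fin 4) : ℝ :=
  (1/2) * (∑ γ : Fin 4, ∑ δ : Fin 4,
      (dgu G γ γ δ p * dgl g α β δ p - dgu G α γ δ p * dgl g γ β δ p))
  + (1/2) * (∑ γ : Fin 4, ∑ δ : Fin 4,
      (dgu G γ γ δ p * dgl g β α δ p - dgu G β γ δ p * dgl g γ α δ p))
  + (1/4) * (∑ ρ : Fin 4, ∑ σ : Fin 4, ∑ δ : Fin 4, ∑ γ : Fin 4,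
      G p ρ σ * G p δ γ * dgl g γ ρ σ p * dgl g δ α β p)

/-- The null-form remainder `Q²`. -/
def Q2 (g G : V4 → Fin 4 → Fin 4 → ℝ) (p : V4) (α β : Fin 4) : ℝ :=
  (1/4) * ∑ γ : Fin 4, ∑ δ : Fin 4,
    (dgu G α γ δ p * dgl g β γ δ p - dgu G β γ δ p * dgl g α γ δ p)

/-- The null-form remainder `Q³`. -/
def Q3 (g G : V4 → Fin 4 → Fin 4 → ℝ) (p : V4) (α β : Fin 4) : ℝ :=
  (1/4) * ∑ ρ : Fin 4, ∑ σ : Fin 4, ∑ γ : Fin 4, ∑ δ : Fin 4,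
    G p ρ σ * G p γ δ *
      ((dgl g ρ γ δ p * dgl g α β σ p - dgl g α γ δ p * dgl g ρ β σ p)
        + (dgl g ρ γ δ p * dgl g β α σ p - dgl g β γ δ p * dgl g ρ α σ p)
        - dgl g ρ γ δ p * dgl g σ α β p)

/-- The null-form remainder `Q⁴`. -/
def Q4 (g G : V4 → Fin 4 → Fin 4 → ℝ) (p : V4) (α β : Fin 4) : ℝ :=
  -(1/4) * (∑ γ : Fin 4, ∑ δ : Fin 4, ∑ ρ : Fin 4, ∑ σ : Fin 4,
      G p γ δ * G p ρ σ *
        ((dgl g α δ ρ p * dgl g γ β σ p - dgl g γ δ ρ p * dgl g α β σ p)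
          - (dgl g α δ ρ p * dgl g σ β γ p - dgl g σ δ ρ p * dgl g α β γ p)))
  - (1/4) * (∑ γ : Fin 4, ∑ δ : Fin 4, ∑ ρ : Fin 4, ∑ σ : Fin 4,
      G p γ δ * G p ρ σ *
        ((dgl g β σ γ p * dgl g ρ α δ p - dgl g ρ σ γ p * dgl g β α δ p)
          - (dgl g β σ γ p * dgl g δ α ρ p - dgl g δ σ γ p * dgl g β α ρ p)))
  + (1/4) * (∑ γ : Fin 4, ∑ δ : Fin 4, ∑ ρ : Fin 4, ∑ σ : Fin 4,
      G p γ δ * G p ρ σ * dgl g ρ α δ p * dgl g σ β γ p)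
  + (1/4) * (∑ γ : Fin 4, ∑ δ : Fin 4, ∑ ρ : Fin 4, ∑ σ : Fin 4,
      G p γ δ * G p ρ σ * dgl g δ α ρ p * dgl g γ β σ p)
  - (1/2) * (∑ γ : Fin 4, ∑ δ : Fin 4, ∑ ρ : Fin 4, ∑ σ : Fin 4,
      G p γ δ * G p ρ σ *
        (dgl g ρ α δ p * dgl g γ β σ p - dgl g γ α δ p * dgl g ρ β σ p))

theorem aux_S_zero (G : Fin 4 → Fin 4 → ℝ) (hG : ∀ a b, G a b = G b a)
    (F : Fin 4 → Fin 4 → Fin 4 → Fin 4 → ℝ)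
    (h : ∀ c d r s, F c d r s + F d c r s + F c d s r + F d c s r
      + F r s c d + F s r c d + F r s d c + F s r d c = 0) :
    ∑ c, ∑ d, ∑ r, ∑ s, G c d * G r s * F c d r s = 0 := by
  have swap12 : ∀ F : Fin 4 → Fin 4 → Fin 4 → Fin 4 → ℝ,
      ∑ c, ∑ d, ∑ r, ∑ s, G c d * G r s * F c d r s
      = ∑ c, ∑ d, ∑ r, ∑ s, G c d * G r s * F d c r s := by
    intro F
    rw [Finset.sum_comm]
    simp only [hG]
  have swap34 : ∀ F : Fin 4 → Fin 4 → Fin 4 → Fin 4 → ℝ,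
      ∑ c, ∑ d, ∑ r, ∑ s, G c d * G r s * F c d r s
      = ∑ c, ∑ d, ∑ r, ∑ s, G c d * G r s * F c d s r := by
    intro F
    refine Finset.sum_congr rfl fun c _ => Finset.sum_congr rfl fun d _ => ?_
    rw [Finset.sum_comm]
    simp only [hG]
  have swapP : ∀ F : Fin 4 → Fin 4 → Fin 4 → Fin 4 → ℝ,
      ∑ c, ∑ d, ∑ r, ∑ s, G c d * G r s * F c d r s
      = ∑ c, ∑ d, ∑ r, ∑ s, G c d * G r s * F r s c d := by
    intro F
    have := Finset.sum_comm (s := (Finset.univ : Finset (Fin 4 × Fin 4)))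
      (t := (Finset.univ : Finset (Fin 4 × Fin 4)))
      (f := fun x y => G x.1 x.2 * G y.1 y.2 * F x.1 x.2 y.1 y.2)
    simp only [Fintype.sum_prod_type] at this
    rw [this]
    simp only [mul_comm]
  have e1 := swap12 F
  have e2 := swap34 F
  have e3 := swap34 (fun c d r s => F d c r s)
  have e4 := swapP F
  have e5 := swapP (fun c d r s => F d c r s)
  have e6 := swapP (fun c d r s => F c d s r)
  have e7 := swapP (fun c d r s => F d c s r)
  have key : ∑ c, ∑ d, ∑ r, ∑ s, G c d * G r s * (F c d r s + F d c r s + F c d s r + F d c s r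
      + F r s c d + F s r c d + F r s d c + F s r d c) = 0 := by
    simp only [h, mul_zero, Finset.sum_const_zero]
  simp only [mul_add, Finset.sum_add_distrib] at key
  linarith

theorem aux_S2_zero (G : Fin 4 → Fin 4 → ℝ) (hG : ∀ a b, G a b = G b a)
    (F : Fin 4 → Fin 4 → ℝ) (h : ∀ c d, F c d + F d c = 0) :
    ∑ c, ∑ d, G c d * F c d = 0 := by
  have e : ∑ c, ∑ d, G c d * F c d = ∑ c, ∑ d, G c d * F d c := by
    rw [Finset.sum_comm]
    simp only [hG]
  have key : ∑ c, ∑ d, G c d * (F c d + F d c) = 0 := by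
    simp only [h, mul_zero, Finset.sum_const_zero]
  simp only [mul_add, Finset.sum_add_distrib] at key
  linarith

theorem aux_dG (G : Fin 4 → Fin 4 → ℝ) (D dG : Fin 4 → Fin 4 → Fin 4 → ℝ)
    (hdG : ∀ m a b, dG m a b = - ∑ c, ∑ d, G a c * D m c d * G d b)
    (m : Fin 4 → Fin 4) (X : Fin 4 → Fin 4 → ℝ) :
    ∑ c, ∑ d, dG (m c) c d * X c d
      = ∑ c, ∑ d, ∑ r, ∑ s, G c d * G r s * (-(D (m c) d r * X c s)) := by
  refine Finset.sum_congr rfl fun c _ => ?_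
  have : ∀ d, dG (m c) c d * X c d
      = ∑ x, ∑ y, G c x * G y d * (-(D (m c) x y * X c d)) := by
    intro d
    rw [hdG, neg_mul, Finset.sum_mul, ← Finset.sum_neg_distrib]
    refine Finset.sum_congr rfl fun x _ => ?_
    rw [Finset.sum_mul, ← Finset.sum_neg_distrib]
    refine Finset.sum_congr rfl fun y _ => ?_
    ring
  simp only [this]
  rw [Finset.sum_comm]
  refine Finset.sum_congr rfl fun x _ => ?_
  rw [Finset.sum_comm]

theorem aux_CC (G : Fin 4 → Fin 4 → ℝ) (A B : Fin 4 → Fin 4 → Fin 4 → ℝ) :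
    ∑ c, ∑ r, ((1/2) * ∑ d, G c d * A d c r) * ((1/2) * ∑ s, G r s * B s c r)
      = ∑ c, ∑ d, ∑ r, ∑ s, G c d * G r s * ((1/4) * (A d c r * B s c r)) := by
  refine Finset.sum_congr rfl fun c _ => ?_
  rw [Finset.sum_comm]
  refine Finset.sum_congr rfl fun r _ => ?_
  rw [mul_mul_mul_comm, Finset.sum_mul_sum, Finset.mul_sum]
  refine Finset.sum_congr rfl fun d _ => ?_
  rw [Finset.mul_sum]
  refine Finset.sum_congr rfl fun s _ => ?_
  ring

theorem aux_prod (G : Fin 4 → Fin 4 → ℝ) (A B : Fin 4 → Fin 4 → ℝ) :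
    (∑ c, ∑ d, G c d * A c d) * (∑ r, ∑ s, G r s * B r s)
      = ∑ c, ∑ d, ∑ r, ∑ s, G c d * G r s * (A c d * B r s) := by
  rw [Finset.sum_mul]
  refine Finset.sum_congr rfl fun c _ => ?_
  rw [Finset.sum_mul]
  refine Finset.sum_congr rfl fun d _ => ?_
  rw [Finset.mul_sum]
  refine Finset.sum_congr rfl fun r _ => ?_
  rw [Finset.mul_sum]
  refine Finset.sum_congr rfl fun s _ => ?_
  ring

theorem aux_up (G : Fin 4 → Fin 4 → ℝ) (T : Fin 4 → Fin 4 → Fin 4 → ℝ) (Y : Fin 4 → ℝ) :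
    ∑ c, (∑ r, ∑ s, G r s * ((1/2) * ∑ d, G c d * T d r s)) * Y c
      = ∑ c, ∑ d, ∑ r, ∑ s, G c d * G r s * ((1/2) * (T d r s * Y c)) := by
  refine Finset.sum_congr rfl fun c _ => ?_
  have : ∑ d, ∑ r, ∑ s, G c d * G r s * ((1/2) * (T d r s * Y c))
      = ∑ r, ∑ s, ∑ d, G c d * G r s * ((1/2) * (T d r s * Y c)) := by
    rw [Finset.sum_comm]
    refine Finset.sum_congr rfl fun r _ => ?_
    rw [Finset.sum_comm]
  rw [this, Finset.sum_mul]
  refine Finset.sum_congr rfl fun r _ => ?_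
  rw [Finset.sum_mul]
  refine Finset.sum_congr rfl fun s _ => ?_
  rw [Finset.mul_sum, Finset.mul_sum, Finset.sum_mul]
  refine Finset.sum_congr rfl fun d _ => ?_
  ring

/-- The purely algebraic identity. -/
theorem aux_alg (G : Fin 4 → Fin 4 → ℝ) (D dG : Fin 4 → Fin 4 → Fin 4 → ℝ)
    (H : Fin 4 → Fin 4 → Fin 4 → Fin 4 → ℝ)
    (hG : ∀ a b, G a b = G b a)
    (hD : ∀ m a b, D m a b = D m b a)
    (hH : ∀ m n a b, H m n a b = H n m a b)
    (hH2 : ∀ m n a b, H m n a b = H m n b a)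
    (hdG : ∀ m a b, dG m a b = - ∑ c, ∑ d, G a c * D m c d * G d b)
    (α β : Fin 4) :
    (∑ γ, (1/2) * ∑ δ, (dG γ γ δ * (D α β δ + D β α δ - D δ α β)
        + G γ δ * (H γ α β δ + H γ β α δ - H γ δ α β)))
    - (∑ γ, (1/2) * ∑ δ, (dG β γ δ * (D α γ δ + D γ α δ - D δ α γ)
        + G γ δ * (H β α γ δ + H β γ α δ - H β δ α γ)))
    + (∑ γ, ∑ ρ, ((1/2) * ∑ δ, G γ δ * (D γ ρ δ + D ρ γ δ - D δ γ ρ))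
        * ((1/2) * ∑ δ, G ρ δ * (D α β δ + D β α δ - D δ α β)))
    - (∑ γ, ∑ ρ, ((1/2) * ∑ δ, G γ δ * (D α ρ δ + D ρ α δ - D δ α ρ))
        * ((1/2) * ∑ δ, G ρ δ * (D β γ δ + D γ β δ - D δ β γ)))
    =
      -(1/2) * (∑ γ, ∑ δ, G γ δ * H γ δ α β)
      + (1/2) * (∑ δ, (∑ r, ∑ s, G r s *
          ((1/2) * ∑ d, G δ d * (D r s d + D s r d - D d r s))) * D δ α β)
      + (1/2) * (((1/2) * ∑ r, ∑ s, (dG α r s * (D r s β + D s r β - D β r s)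
            + G r s * (H α r s β + H α s r β - H α β r s)))
          + ((1/2) * ∑ r, ∑ s, (dG β r s * (D r s α + D s r α - D α r s)
            + G r s * (H β r s α + H β s r α - H β α r s))))
      - (1/2) * ((1/2) * ∑ r, ∑ s, G r s * (D r s α + D s r α - D α r s))
          * ((1/2) * ∑ r, ∑ s, G r s * (D r s β + D s r β - D β r s))
      + (1/2) * (∑ γ, (1/2) * ∑ δ, G γ δ * (D α γ δ + D γ α δ - D δ α γ))
          * (∑ γ, (1/2) * ∑ δ, G γ δ * (D β γ δ + D γ β δ - D δ β γ))
      - (1/4) * (∑ γ, ∑ δ, ∑ ρ, ∑ σ, G γ δ * G ρ σ * D α δ ρ * D β σ γ)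
      + ((1/2) * (∑ γ, ∑ δ, (dG γ γ δ * D α β δ - dG α γ δ * D γ β δ))
        + (1/2) * (∑ γ, ∑ δ, (dG γ γ δ * D β α δ - dG β γ δ * D γ α δ))
        + (1/4) * (∑ ρ, ∑ σ, ∑ δ, ∑ γ, G ρ σ * G δ γ * D γ ρ σ * D δ α β))
      + ((1/4) * ∑ γ, ∑ δ, (dG α γ δ * D β γ δ - dG β γ δ * D α γ δ))
      + ((1/4) * ∑ ρ, ∑ σ, ∑ γ, ∑ δ, G ρ σ * G γ δ *
          ((D ρ γ δ * D α β σ - D α γ δ * D ρ β σ)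
            + (D ρ γ δ * D β α σ - D β γ δ * D ρ α σ)
            - D ρ γ δ * D σ α β))
      + (-(1/4) * (∑ γ, ∑ δ, ∑ ρ, ∑ σ, G γ δ * G ρ σ *
            ((D α δ ρ * D γ β σ - D γ δ ρ * D α β σ)
              - (D α δ ρ * D σ β γ - D σ δ ρ * D α β γ)))
        - (1/4) * (∑ γ, ∑ δ, ∑ ρ, ∑ σ, G γ δ * G ρ σ *
            ((D β σ γ * D ρ α δ - D ρ σ γ * D β α δ)
              - (D β σ γ * D δ α ρ - D δ σ γ * D β α ρ)))
        + (1/4) * (∑ γ, ∑ δ, ∑ ρ, ∑ σ, G γ δ * G ρ σ * D ρ α δ * D σ β γ)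
        + (1/4) * (∑ γ, ∑ δ, ∑ ρ, ∑ σ, G γ δ * G ρ σ * D δ α ρ * D γ β σ)
        - (1/2) * (∑ γ, ∑ δ, ∑ ρ, ∑ σ, G γ δ * G ρ σ *
            (D ρ α δ * D γ β σ - D γ α δ * D ρ β σ))) := by
  have h1 := aux_S2_zero G hG (fun c d =>
      (1/2) * (H c α β d + H c β α d - H c d α β)
      - (1/2) * (H β α c d + H β c α d - H β d α c)
      + (1/2) * H c d α β
      - (1/4) * (H α c d β + H α d c β - H α β c d)
      - (1/4) * (H β c d α + H β d c α - H β α c d)) (by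
    intro c d
    simp only [hH2 _ _ β α, hH2 _ _ c α, hH2 _ _ c β, hH2 _ _ d α, hH2 _ _ d β, hH2 _ _ d c,
      hH β α, hH c α, hH c β, hH d α, hH d β, hH d c]
    ring)
  have h2 := aux_S_zero G hG (fun c d r s =>
      (1/2) * (-(D c d r * (D α β s + D β α s - D s α β)))
      - (1/2) * (-(D β d r * (D α c s + D c α s - D s α c)))
      + (1/4) * ((D c r d + D r c d - D d c r) * (D α β s + D β α s - D s α β))
      - (1/4) * ((D α r d + D r α d - D d α r) * (D β c s + D c β s - D s β c))
      - (1/2) * ((1/2) * ((D r s d + D s r d - D d r s) * D c α β))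
      - (1/4) * (-(D α d r * (D c s β + D s c β - D β c s)))
      - (1/4) * (-(D β d r * (D c s α + D s c α - D α c s)))
      + (1/8) * ((D c d α + D d c α - D α c d) * (D r s β + D s r β - D β r s))
      - (1/8) * ((D α c d + D c α d - D d α c) * (D β r s + D r β s - D s β r))
      + (1/4) * (D α d r * D β s c)
      - (1/2) * (-(D c d r * D α β s)) + (1/2) * (-(D α d r * D c β s))
      - (1/2) * (-(D c d r * D β α s)) + (1/2) * (-(D β d r * D c α s))
      - (1/4) * (D s c d * D r α β)
      - (1/4) * (-(D α d r * D β c s)) + (1/4) * (-(D β d r * D α c s))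
      - (1/4) * ((D c r s * D α β d - D α r s * D c β d)
            + (D c r s * D β α d - D β r s * D c α d)
            - D c r s * D d α β)
      + (1/4) * ((D α d r * D c β s - D c d r * D α β s)
              - (D α d r * D s β c - D s d r * D α β c))
      + (1/4) * ((D β s c * D r α d - D r s c * D β α d)
              - (D β s c * D d α r - D d s c * D β α r))
      - (1/4) * (D r α d * D s β c)
      - (1/4) * (D d α r * D c β s)
      + (1/2) * (D r α d * D c β s - D c α d * D r β s)) (by
    intro c d r s
    simp only [hD _ β α, hD _ c α, hD _ c β, hD _ d α, hD _ d β, hD _ r α, hD _ r β, hD _ s α,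
      hD _ s β, hD _ d c, hD _ r c, hD _ s c, hD _ r d, hD _ s d, hD _ s r]
    ring)
  have k1 := aux_dG G D dG hdG (fun c => c) (fun _ s => D α β s + D β α s - D s α β)
  have k2 := aux_dG G D dG hdG (fun _ => β) (fun c s => D α c s + D c α s - D s α c)
  have k3 := aux_CC G (fun d c r => D c r d + D r c d - D d c r)
    (fun s _ _ => D α β s + D β α s - D s α β)
  have k4 := aux_CC G (fun d c r => D α r d + D r α d - D d α r)
    (fun s c _ => D β c s + D c β s - D s β c)
  have k5 := aux_up G (fun d r s => D r s d + D s r d - D d r s) (fun c => D c α β)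
  have k6 := aux_dG G D dG hdG (fun _ => α) (fun c s => D c s β + D s c β - D β c s)
  have k7 := aux_dG G D dG hdG (fun _ => β) (fun c s => D c s α + D s c α - D α c s)
  have k8 := aux_prod G (fun c d => D c d α + D d c α - D α c d)
    (fun c d => D c d β + D d c β - D β c d)
  have k9 := aux_prod G (fun c d => D α c d + D c α d - D d α c)
    (fun c d => D β c d + D c β d - D d β c)
  have k10 := aux_dG G D dG hdG (fun c => c) (fun _ s => D α β s)
  have k11 := aux_dG G D dG hdG (fun _ => α) (fun c s => D c β s)
  have k12 := aux_dG G D dG hdG (fun c => c) (fun _ s => D β α s)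
  have k13 := aux_dG G D dG hdG (fun _ => β) (fun c s => D c α s)
  have k14 := aux_dG G D dG hdG (fun _ => α) (fun c s => D β c s)
  have k15 := aux_dG G D dG hdG (fun _ => β) (fun c s => D α c s)
  have S4 : ∀ (P Q : Fin 4 → Fin 4 → Fin 4 → Fin 4 → ℝ),
      ∑ c, ∑ d, ∑ r, ∑ s, G c d * G r s * P c d r s * Q c d r s
      = ∑ c, ∑ d, ∑ r, ∑ s, G c d * G r s * (P c d r s * Q c d r s) := by
    intro P Q; simp only [mul_assoc]
  obtain ⟨S, hS⟩ : ∃ S : (Fin 4 → Fin 4 → Fin 4 → Fin 4 → ℝ) → ℝ, ∀ F,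
      ∑ c, ∑ d, ∑ r, ∑ s, G c d * G r s * F c d r s = S F := ⟨_, fun _ => rfl⟩
  obtain ⟨S2, hS2⟩ : ∃ S2 : (Fin 4 → Fin 4 → ℝ) → ℝ, ∀ F,
      ∑ c, ∑ d, G c d * F c d = S2 F := ⟨_, fun _ => rfl⟩
  have a1 : ∀ P Q, S (fun c d r s => P c d r s + Q c d r s) = S P + S Q := by
    intro P Q; simp only [← hS, mul_add, Finset.sum_add_distrib]
  have a2 : ∀ P Q, S (fun c d r s => P c d r s - Q c d r s) = S P - S Q := by
    intro P Q; simp only [← hS, mul_sub, Finset.sum_sub_distrib]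
  have a3 : ∀ P, S (fun c d r s => - P c d r s) = - S P := by
    intro P; simp only [← hS, mul_neg, Finset.sum_neg_distrib]
  have a4 : ∀ (k : ℝ) P, S (fun c d r s => k * P c d r s) = k * S P := by
    intro k P; simp only [← hS, Finset.mul_sum]; simp only [mul_left_comm]
  have b1 : ∀ P Q, S2 (fun c d => P c d + Q c d) = S2 P + S2 Q := by
    intro P Q; simp only [← hS2, mul_add, Finset.sum_add_distrib]
  have b2 : ∀ P Q, S2 (fun c d => P c d - Q c d) = S2 P - S2 Q := by
    intro P Q; simp only [← hS2, mul_sub, Finset.sum_sub_distrib]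
  have b4 : ∀ (k : ℝ) P, S2 (fun c d => k * P c d) = k * S2 P := by
    intro k P; simp only [← hS2, Finset.mul_sum]; simp only [mul_left_comm]
  rw [k3, k4, k5,
    S4 (fun c d r s => D α d r) (fun c d r s => D β s c),
    S4 (fun c d r s => D s c d) (fun c d r s => D r α β),
    S4 (fun c d r s => D r α d) (fun c d r s => D s β c),
    S4 (fun c d r s => D d α r) (fun c d r s => D c β s)]
  have k8' : -(1/2) * ((1/2) * ∑ r, ∑ s, G r s * (D r s α + D s r α - D α r s))
          * ((1/2) * ∑ r, ∑ s, G r s * (D r s β + D s r β - D β r s)) = _ :=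
    Eq.trans (by ring) (congrArg (fun x => -(1/8) * x) k8)
  have k9' : (1/2) * (∑ γ, (1/2) * ∑ δ, G γ δ * (D α γ δ + D γ α δ - D δ α γ))
          * (∑ γ, (1/2) * ∑ δ, G γ δ * (D β γ δ + D γ β δ - D δ β γ)) = _ :=
    Eq.trans (by simp only [← Finset.mul_sum]; ring) (congrArg (fun x => (1/8) * x) k9)
  rw [sub_eq_add_neg _ ((1/2) * ((1/2) * _) * _), ← neg_mul, ← neg_mul, k8', k9']
  clear k8' k9' k8 k9 k3 k4 k5 S4
  simp only [← Finset.mul_sum, Finset.sum_add_distrib, Finset.sum_sub_distrib]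
  simp only [hS] at h2 k1 k2 k6 k7 k10 k11 k12 k13 k14 k15 ⊢
  simp only [hS2] at h1 ⊢
  rw [k1, k2, k6, k7, k10, k11, k12, k13, k14, k15]
  simp only [b1, b2, b4] at h1 ⊢
  simp only [a1, a2, a3, a4] at h2 ⊢
  linarith

theorem aux_pd_mul {f h : V4 → ℝ} {p : V4} (m : Fin 4) (hf : DifferentiableAt ℝ f p)
    (hh : DifferentiableAt ℝ h p) :
    pd4 m (fun q => f q * h q) p = pd4 m f p * h p + f p * pd4 m h p := by
  unfold pd4
  rw [fderiv_fun_mul hf hh]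
  simp
  ring

theorem aux_pd_sum {f : Fin 4 → V4 → ℝ} {p : V4} (m : Fin 4)
    (hf : ∀ i, DifferentiableAt ℝ (f i) p) :
    pd4 m (fun q => ∑ i, f i q) p = ∑ i, pd4 m (f i) p := by
  unfold pd4
  rw [fderiv_fun_sum (fun i _ => hf i)]
  simp

theorem aux_pd_cmul {f : V4 → ℝ} {p : V4} (m : Fin 4) (k : ℝ) (hf : DifferentiableAt ℝ f p) :
    pd4 m (fun q => k * f q) p = k * pd4 m f p := by
  unfold pd4
  rw [fderiv_const_mul hf]
  simp

theorem aux_pd_T {a b c : V4 → ℝ} {p : V4} (m : Fin 4) (ha : DifferentiableAt ℝ a p)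
    (hb : DifferentiableAt ℝ b p) (hc : DifferentiableAt ℝ c p) :
    pd4 m (fun q => a q + b q - c q) p = pd4 m a p + pd4 m b p - pd4 m c p := by
  unfold pd4
  rw [fderiv_fun_sub (ha.fun_add hb) hc, fderiv_fun_add ha hb]
  simp

theorem aux_pd_congr {a b : V4 → ℝ} {p : V4} (m : Fin 4) {U : Set V4} (hU : IsOpen U)
    (hp : p ∈ U) (h : ∀ q ∈ U, a q = b q) : pd4 m a p = pd4 m b p := by
  unfold pd4
  have : a =ᶠ[nhds p] b := Filter.eventually_of_mem (hU.mem_nhds hp) h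
  rw [this.fderiv_eq]

theorem aux_det_diff {A : V4 → Matrix (Fin 4) (Fin 4) ℝ} {p : V4}
    (h : ∀ a b, DifferentiableAt ℝ (fun q => A q a b) p) :
    DifferentiableAt ℝ (fun q => (A q).det) p := by
  simp only [Matrix.det_apply]
  fun_prop

theorem aux_inv_left {g G : Fin 4 → Fin 4 → ℝ}
    (hinv : ∀ α β, (∑ γ, g α γ * G γ β) = if α = β then 1 else 0) (α β : Fin 4) :
    (∑ γ, G α γ * g γ β) = if α = β then 1 else 0 := by
  have h : (Matrix.of g) * (Matrix.of G) = 1 := by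
    ext a b
    simp [Matrix.mul_apply, hinv, Matrix.one_apply]
  have h1 := mul_eq_one_comm.mp h
  have h2 := congrFun (congrFun h1 α) β
  simpa [Matrix.mul_apply, Matrix.one_apply] using h2

theorem aux_G_sym {g G : Fin 4 → Fin 4 → ℝ} (hsym : ∀ a b, g a b = g b a)
    (hinv : ∀ α β, (∑ γ, g α γ * G γ β) = if α = β then 1 else 0) (α β : Fin 4) :
    G α β = G β α := by
  have h : (Matrix.of g) * (Matrix.of G) = 1 := by
    ext a b
    simp [Matrix.mul_apply, hinv, Matrix.one_apply]
  have hs : (Matrix.of g).transpose = Matrix.of g := by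
    ext a b
    simp [hsym a b]
  have h1 := mul_eq_one_comm.mp h
  have h2 := congrArg Matrix.transpose h
  rw [Matrix.transpose_mul, hs, Matrix.transpose_one] at h2
  have h3 := left_inv_eq_right_inv h2 h
  exact congrFun (congrFun h3 β) α

theorem aux_G_diff {g G : V4 → Fin 4 → Fin 4 → ℝ} {U : Set V4} (hU : IsOpen U) {p : V4}
    (hp : p ∈ U)
    (hinv : ∀ p ∈ U, ∀ α β : Fin 4,
      (∑ γ : Fin 4, g p α γ * G p γ β) = if α = β then 1 else 0)
    (hg : ∀ a b, DifferentiableAt ℝ (fun q => g q a b) p) (a b : Fin 4) :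
    DifferentiableAt ℝ (fun q => G q a b) p := by
  have hm : ∀ q ∈ U, (Matrix.of (g q)) * (Matrix.of (G q)) = 1 := by
    intro q hq
    ext a b
    simp [Matrix.mul_apply, hinv q hq, Matrix.one_apply]
  have hdet : ∀ q ∈ U, (Matrix.of (g q)).det ≠ 0 := by
    intro q hq h0
    have := congrArg Matrix.det (hm q hq)
    rw [Matrix.det_mul, h0, zero_mul, Matrix.det_one] at this
    exact zero_ne_one this
  have hG : ∀ q ∈ U, G q a b
      = ((Matrix.of (g q)).det)⁻¹ * ((Matrix.of (g q)).updateRow b (Pi.single a 1)).det := by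
    intro q hq
    have h1 : (Matrix.of (g q))⁻¹ = Matrix.of (G q) := Matrix.inv_eq_right_inv (hm q hq)
    have h2 := congrFun (congrFun h1 a) b
    rw [Matrix.inv_def, Matrix.smul_apply, Matrix.adjugate_apply, Ring.inverse_eq_inv'] at h2
    exact h2.symm
  have hev : (fun q => G q a b) =ᶠ[nhds p] _ := Filter.eventually_of_mem (hU.mem_nhds hp) hG
  rw [hev.differentiableAt_iff]
  refine DifferentiableAt.mul (DifferentiableAt.inv (aux_det_diff hg) (hdet p hp))
    (aux_det_diff ?_)
  intro i j
  by_cases hi : i = b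
  · subst hi
    simp
  · simpa [Matrix.updateRow_ne hi] using hg i j

theorem aux_low {g G : V4 → Fin 4 → Fin 4 → ℝ} {q : V4}
    (hinv : ∀ α β, (∑ γ, g q α γ * G q γ β) = if α = β then 1 else 0) (a : Fin 4) :
    ChrLow g G q a = (1/2) * ∑ r, ∑ s, G q r s * (dgl g r s a q + dgl g s r a q - dgl g a r s q) := by
  unfold ChrLow ChrUp Chr
  simp only [Finset.mul_sum]
  rw [Finset.sum_comm]
  refine Finset.sum_congr rfl fun r _ => ?_
  rw [Finset.sum_comm]
  refine Finset.sum_congr rfl fun s _ => ?_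
  rw [Finset.sum_comm]
  have : ∀ e, ∑ d, g q a d * (G q r s * (1 / 2 * (G q d e *
      (dgl g r s e q + dgl g s r e q - dgl g e r s q))))
      = (∑ d, g q a d * G q d e) * ((1/2) * (G q r s *
      (dgl g r s e q + dgl g s r e q - dgl g e r s q))) := by
    intro e
    rw [Finset.sum_mul]
    refine Finset.sum_congr rfl fun d _ => ?_
    ring
  simp only [this, hinv]
  simp

theorem aux_dG_formula {g G : V4 → Fin 4 → Fin 4 → ℝ} {U : Set V4} (hU : IsOpen U) {p : V4}
    (hp : p ∈ U)
    (hinv : ∀ p ∈ U, ∀ α β : Fin 4,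
      (∑ γ : Fin 4, g p α γ * G p γ β) = if α = β then 1 else 0)
    (hg : ∀ a b, DifferentiableAt ℝ (fun q => g q a b) p)
    (hG : ∀ a b, DifferentiableAt ℝ (fun q => G q a b) p) (m a b : Fin 4) :
    dgu G m a b p = - ∑ c, ∑ d, G p a c * dgl g m c d p * G p d b := by
  have h0 : ∀ c, ∑ d, dgl g m c d p * G p d b + ∑ d, g p c d * dgu G m d b p = 0 := by
    intro c
    have h1 : pd4 m (fun q => ∑ d, g q c d * G q d b) p = 0 := by
      rw [aux_pd_congr m hU hp (fun q hq => hinv q hq c b)]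
      simp [pd4]
    rw [aux_pd_sum m (fun d => (hg c d).fun_mul (hG d b))] at h1
    rw [← Finset.sum_add_distrib, ← h1]
    refine Finset.sum_congr rfl fun d _ => ?_
    rw [aux_pd_mul m (hg c d) (hG d b)]
    rfl
  have h2 : dgu G m a b p = ∑ c, G p a c * ∑ d, g p c d * dgu G m d b p := by
    simp only [Finset.mul_sum]
    rw [Finset.sum_comm]
    have : ∀ d, ∑ c, G p a c * (g p c d * dgu G m d b p)
        = (∑ c, G p a c * g p c d) * dgu G m d b p := by
      intro d
      rw [Finset.sum_mul]
      simp only [mul_assoc]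
    simp only [this, aux_inv_left (hinv p hp)]
    simp
  rw [h2, ← Finset.sum_neg_distrib]
  refine Finset.sum_congr rfl fun c _ => ?_
  rw [eq_neg_of_add_eq_zero_right (h0 c), mul_neg, Finset.mul_sum]
  simp only [mul_assoc]

/-- **Ricci curvature in a form adapted to generalized wave coordinates** (Lemma A.1). -/
theorem ricci_generalized_wave_identity
    (U : Set V4) (hU : IsOpen U)
    (g G : V4 → Fin 4 → Fin 4 → ℝ)
    (hg : ContDiffOn ℝ 2 g U)
    (hsym : ∀ p ∈ U, ∀ a b : Fin 4, g p a b = g p b a)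
    (hinv : ∀ p ∈ U, ∀ α β : Fin 4,
      (∑ γ : Fin 4, g p α γ * G p γ β) = if α = β then 1 else 0)
    (p : V4) (hp : p ∈ U) (α β : Fin 4) :
    Ric g G p α β =
      -(1/2) * (∑ γ : Fin 4, ∑ δ : Fin 4, G p γ δ * pd4 γ (fun q => pd4 δ (fun r => g r α β) q) p)
      + (1/2) * (∑ δ : Fin 4, ChrUp g G p δ * dgl g δ α β p)
      + (1/2) * (pd4 α (fun q => ChrLow g G q β) p + pd4 β (fun q => ChrLow g G q α) p)
      - (1/2) * ChrLow g G p α * ChrLow g G p β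
      + (1/2) * (∑ γ : Fin 4, Chr g G p γ α γ) * (∑ ρ : Fin 4, Chr g G p ρ β ρ)
      - (1/4) * (∑ γ : Fin 4, ∑ δ : Fin 4, ∑ ρ : Fin 4, ∑ σ : Fin 4,
          G p γ δ * G p ρ σ * dgl g α δ ρ p * dgl g β σ γ p)
      + Q1 g G p α β + Q2 g G p α β + Q3 g G p α β + Q4 g G p α β := by
  have hc : ∀ q ∈ U, ∀ a b, ContDiffAt ℝ 2 (fun q => g q a b) q := by
    intro q hq a b
    have h1 := hg.contDiffAt (hU.mem_nhds hq)
    exact contDiffAt_pi.mp (contDiffAt_pi.mp h1 a) b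
  have hgd : ∀ q ∈ U, ∀ a b, DifferentiableAt ℝ (fun q => g q a b) q := fun q hq a b =>
    (hc q hq a b).differentiableAt (by norm_num)
  have hGd : ∀ a b, DifferentiableAt ℝ (fun q => G q a b) p :=
    aux_G_diff hU hp hinv (hgd p hp)
  have hfd : ∀ a b, DifferentiableAt ℝ (fderiv ℝ (fun q => g q a b)) p := fun a b =>
    ((hc p hp a b).fderiv_right (m := 1) (by norm_num)).differentiableAt (by norm_num)
  have hDd : ∀ m a b, DifferentiableAt ℝ (fun q => dgl g m a b q) p := by
    intro m a b
    unfold dgl pd4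
    exact (hfd a b).clm_apply (differentiableAt_const _)
  have hTd : ∀ m a b m' a' b' m'' a'' b'', DifferentiableAt ℝ
      (fun q => dgl g m a b q + dgl g m' a' b' q - dgl g m'' a'' b'' q) p := by
    intro m a b m' a' b' m'' a'' b''
    exact ((hDd m a b).fun_add (hDd m' a' b')).fun_sub (hDd m'' a'' b'')
  have hGs : ∀ a b, G p a b = G p b a := aux_G_sym (hsym p hp) (hinv p hp)
  have hDs : ∀ q ∈ U, ∀ m a b, dgl g m a b q = dgl g m b a q := fun q hq m a b =>
    aux_pd_congr m hU hq (fun r hr => hsym r hr a b)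
  have hH2 : ∀ m n a b, pd4 m (fun q => dgl g n a b q) p = pd4 m (fun q => dgl g n b a q) p :=
    fun m n a b => aux_pd_congr m hU hp (fun q hq => hDs q hq n a b)
  have hHe : ∀ m n a b, pd4 m (fun q => dgl g n a b q) p
      = fderiv ℝ (fderiv ℝ (fun q => g q a b)) p (Pi.single m 1) (Pi.single n 1) := by
    intro m n a b
    unfold dgl pd4
    rw [fderiv_clm_apply (hfd a b) (differentiableAt_const _)]
    simp
  have hH : ∀ m n a b, pd4 m (fun q => dgl g n a b q) p = pd4 n (fun q => dgl g m a b q) p := by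
    intro m n a b
    rw [hHe, hHe]
    exact (hc p hp a b).isSymmSndFDerivAt (by simp) _ _
  have hChr : ∀ m c a b, pd4 m (fun q => Chr g G q c a b) p
      = (1/2) * ∑ d, (dgu G m c d p * (dgl g a b d p + dgl g b a d p - dgl g d a b p)
        + G p c d * (pd4 m (fun q => dgl g a b d q) p + pd4 m (fun q => dgl g b a d q) p
          - pd4 m (fun q => dgl g d a b q) p)) := by
    intro m c a b
    have hd : ∀ d, DifferentiableAt ℝ (fun q => G q c d *
        (dgl g a b d q + dgl g b a d q - dgl g d a b q)) p := fun d =>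
      (hGd c d).fun_mul (hTd _ _ _ _ _ _ _ _ _)
    unfold Chr
    rw [aux_pd_cmul m _ (DifferentiableAt.fun_sum fun d _ => hd d), aux_pd_sum m hd]
    congr 1
    refine Finset.sum_congr rfl fun d _ => ?_
    rw [aux_pd_mul m (hGd c d) (hTd _ _ _ _ _ _ _ _ _),
      aux_pd_T m (hDd _ _ _) (hDd _ _ _) (hDd _ _ _)]
    rfl
  have hLow : ∀ m a, pd4 m (fun q => ChrLow g G q a) p
      = (1/2) * ∑ r, ∑ s, (dgu G m r s p * (dgl g r s a p + dgl g s r a p - dgl g a r s p)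
        + G p r s * (pd4 m (fun q => dgl g r s a q) p + pd4 m (fun q => dgl g s r a q) p
          - pd4 m (fun q => dgl g a r s q) p)) := by
    intro m a
    have hd : ∀ r s, DifferentiableAt ℝ (fun q => G q r s *
        (dgl g r s a q + dgl g s r a q - dgl g a r s q)) p := fun r s =>
      (hGd r s).fun_mul (hTd _ _ _ _ _ _ _ _ _)
    have hd2 : ∀ r, DifferentiableAt ℝ (fun q => ∑ s, G q r s *
        (dgl g r s a q + dgl g s r a q - dgl g a r s q)) p := fun r =>
      DifferentiableAt.fun_sum fun s _ => hd r s
    rw [aux_pd_congr m hU hp (fun q hq => aux_low (hinv q hq) a),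
      aux_pd_cmul m _ (DifferentiableAt.fun_sum fun r _ => hd2 r), aux_pd_sum m hd2]
    congr 1
    refine Finset.sum_congr rfl fun r _ => ?_
    rw [aux_pd_sum m (hd r)]
    refine Finset.sum_congr rfl fun s _ => ?_
    rw [aux_pd_mul m (hGd r s) (hTd _ _ _ _ _ _ _ _ _),
      aux_pd_T m (hDd _ _ _) (hDd _ _ _) (hDd _ _ _)]
    rfl
  have key := aux_alg (G p) (fun m a b => dgl g m a b p) (fun m a b => dgu G m a b p)
    (fun m n a b => pd4 m (fun q => dgl g n a b q) p) hGs (hDs p hp) hH hH2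
    (aux_dG_formula hU hp hinv (hgd p hp) hGd) α β
  unfold Ric
  rw [hLow α β, hLow β α, aux_low (hinv p hp) α, aux_low (hinv p hp) β]
  simp only [hChr]
  exact key
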